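/- arXiv:1908.10987 — 3 statements merged into one kernel-verified Lean document; each statement's English description precedes it below -/
import Mathlib

section
/- Let 𝒢 be a Grothendieck category and n ≥ 2. An object M is of type FP_n if and only if M is of type FP_{n−1} and Ext^1_𝒢(M,N) = 0 for every FP_n-injective object N. That is, FP_n = FP_{n−1} ∩ ⊥₁(FP_n-Inj). -/
open CategoryTheory Category Limits Opposite

universe v u

namespace FPnPaper

variable {C : Type u} [Category.{v} C] [Abelian C] [HasColimits C] [HasExt.{v} C]

/-- `X` is finitely generated: `Hom(X,-)` preserves direct limits of systems of
monomorphisms (direct unions of subobjects). -/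
def IsFG (X : C) : Prop :=
  ∀ (J : Type v) (_ : SmallCategory J) (_ : IsFiltered J) (D : J ⥤ C),
    (∀ ⦃j j' : J⦄ (f : j ⟶ j'), Mono (D.map f)) →
    Nonempty (IsColimit ((coyoneda.obj (op X)).mapCocone (colimit.cocone D)))

/-- `X` is finitely presented: `Hom(X,-)` preserves direct limits. -/
def IsFP (X : C) : Prop :=
  ∀ (J : Type v) (_ : SmallCategory J) (_ : IsFiltered J) (D : J ⥤ C),
    Nonempty (IsColimit ((coyoneda.obj (op X)).mapCocone (colimit.cocone D)))

/-- `Ext^n(X,-)` preserves direct limits. -/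
def ExtPreservesDirlim (n : ℕ) (X : C) : Prop :=
  ∀ (J : Type v) (_ : SmallCategory J) (_ : IsFiltered J) (D : J ⥤ C),
    Nonempty (IsColimit ((Abelian.extFunctorObj X n).mapCocone (colimit.cocone D)))

/-- `X` is of type `FP_n`: it is finitely generated and `Ext^i(X,-)` preserves
direct limits for all `0 ≤ i ≤ n - 1`. -/
def IsTypeFP (n : ℕ) (X : C) : Prop :=
  IsFG X ∧ ∀ i < n, ExtPreservesDirlim i X

/-- `X` is of type `FP_∞`. -/
def IsTypeFPInfty (X : C) : Prop :=
  IsFG X ∧ ∀ i : ℕ, ExtPreservesDirlim i X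

/-- `A` is `FP_n`-injective: `Ext^1(F, A) = 0` for every `F` of type `FP_n`. -/
def IsFPInj (n : ℕ) (A : C) : Prop :=
  ∀ F : C, IsTypeFP n F → Subsingleton (Abelian.Ext F A 1)

/-- `X` belongs to the left `Ext`-orthogonal class of the `FP_n`-injective objects. -/
def LeftOrth (n : ℕ) (X : C) : Prop :=
  ∀ Y : C, IsFPInj n Y → Subsingleton (Abelian.Ext X Y 1)

/-- `f, g` form a short exact sequence `0 → A → B → Z → 0`. -/
def IsSES {A B Z : C} (f : A ⟶ B) (g : B ⟶ Z) : Prop :=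
  ∃ w : f ≫ g = 0, (ShortComplex.mk f g w).ShortExact

/-- `X` admits an exact sequence `P_n → ⋯ → P_1 → P_0 → X → 0` where every
`P_i` satisfies the predicate `good`. -/
def HasNPresentation (good : C → Prop) (n : ℕ) (X : C) : Prop :=
  ∃ (P : ℕ → C) (d : ∀ i, P (i + 1) ⟶ P i) (π : P 0 ⟶ X)
    (w0 : d 0 ≫ π = 0) (w : ∀ i, d (i + 1) ≫ d i = 0),
    (∀ i ≤ n, good (P i)) ∧ Epi π ∧
    (0 < n → (ShortComplex.mk (d 0) π w0).Exact) ∧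
    (∀ i, i + 1 < n → (ShortComplex.mk (d (i + 1)) (d i) (w i)).Exact)

/-- `X` is an `n`-coherent object: it is of type `FP_n` and every subobject of `X`
of type `FP_{n-1}` is of type `FP_n` (for `n = 0`, type `FP_{-1}` means no condition). -/
def IsCoherentObj (n : ℕ) (X : C) : Prop :=
  IsTypeFP n X ∧
    ∀ (S : C) (f : S ⟶ X), Mono f → (n = 0 ∨ IsTypeFP (n - 1) S) → IsTypeFP n S

/-- A class of objects is thick: closed under direct summands and satisfying the
two-out-of-three property on short exact sequences. -/
def IsThickClass (P : C → Prop) : Prop :=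
  (∀ (A B X : C), (X ≅ A ⊞ B) → P X → P A) ∧
    ∀ ⦃A B Z : C⦄ (f : A ⟶ B) (g : B ⟶ Z), IsSES f g →
      ((P A → P B → P Z) ∧ (P A → P Z → P B) ∧ (P B → P Z → P A))

/-- A class of objects is closed under extensions. -/
def ClosedUnderExtensions (P : C → Prop) : Prop :=
  ∀ ⦃A B Z : C⦄ (f : A ⟶ B) (g : B ⟶ Z), IsSES f g → P A → P Z → P B

/-- `M` is Gorenstein `FP_n`-injective: `M` is the zeroth cycle of an exact complex
of injectives which stays exact under `Hom(J, -)` for every `FP_n`-injective `J`. -/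
def IsGorFPInj (n : ℕ) (M : C) : Prop :=
  ∃ (I : ℤ → C) (d : ∀ i : ℤ, I i ⟶ I (i + 1)) (w : ∀ i, d i ≫ d (i + 1) = 0),
    (∀ i, Injective (I i)) ∧
    (∀ i, (ShortComplex.mk (d i) (d (i + 1)) (w i)).Exact) ∧
    (∀ (J : C), IsFPInj n J → ∀ (i : ℤ) (f : J ⟶ I (i + 1)), f ≫ d (i + 1) = 0 →
      ∃ g : J ⟶ I i, g ≫ d i = f) ∧
    Nonempty (M ≅ kernel (d 0))

open Abelian ZeroObject

omit [HasColimits C] in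
lemma ext_sub_comp_mk₀ {X Y Z : C} {n : ℕ} (x y : Ext X Y n) (f : Y ⟶ Z) :
    (x - y).comp (Ext.mk₀ f) (add_zero n) =
      x.comp (Ext.mk₀ f) (add_zero n) - y.comp (Ext.mk₀ f) (add_zero n) :=
  map_sub ((Ext.mk₀ f).postcomp X (add_zero n)) x y

/-- Elementwise description of the preservation of direct limits by `Ext^n(X,-)`. -/
lemma extPreservesDirlim_iff (n : ℕ) (X : C) :
    ExtPreservesDirlim n X ↔
      ∀ (J : Type v) [SmallCategory J] [IsFiltered J] (D : J ⥤ C),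
        (∀ x : Ext X (colimit D) n, ∃ (j : J) (y : Ext X (D.obj j) n),
          y.comp (Ext.mk₀ (colimit.ι D j)) (add_zero n) = x) ∧
        ∀ (j : J) (y : Ext X (D.obj j) n),
          y.comp (Ext.mk₀ (colimit.ι D j)) (add_zero n) = 0 →
            ∃ (k : J) (f : j ⟶ k), y.comp (Ext.mk₀ (D.map f)) (add_zero n) = 0 := by
  constructor
  · intro h J _ _ D
    obtain ⟨hc⟩ := h J _ inferInstance D
    have hc' := isColimitOfPreserves (forget AddCommGrpCat) hc
    refine ⟨fun x ↦ ?_, fun j y hy ↦ ?_⟩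
    · obtain ⟨j, y, hy⟩ := Types.jointly_surjective_of_isColimit hc' x
      exact ⟨j, y, hy⟩
    · obtain ⟨k, f, hf⟩ := (Types.FilteredColimit.isColimit_eq_iff' hc' y
        (0 : Ext X (D.obj j) n)).1 (hy.trans (map_zero (((extFunctorObj X n).map (colimit.ι D j)).hom)).symm)
      exact ⟨k, f, hf.trans (map_zero (((extFunctorObj X n).map (D.map f)).hom))⟩
  · intro h J _ _ D
    obtain ⟨hsurj, hinj⟩ := h J D
    have : ReflectsColimit (D ⋙ extFunctorObj X n) (forget AddCommGrpCat) :=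
      reflectsColimit_of_reflectsIsomorphisms _ _
    refine ⟨isColimitOfReflects (forget AddCommGrpCat)
      (Types.FilteredColimit.isColimitOf' _ _ (fun x ↦ ?_) (fun j x y hxy ↦ ?_))⟩
    · obtain ⟨j, y, hy⟩ := hsurj x
      exact ⟨j, y, hy.symm⟩
    · let x' : Ext X (D.obj j) n := x
      let y' : Ext X (D.obj j) n := y
      have hxy' : x'.comp (Ext.mk₀ (colimit.ι D j)) (add_zero n) =
        y'.comp (Ext.mk₀ (colimit.ι D j)) (add_zero n) := hxy
      obtain ⟨k, f, hf⟩ := hinj j (x' - y') (by rw [ext_sub_comp_mk₀, hxy', sub_self])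
      rw [ext_sub_comp_mk₀, sub_eq_zero] at hf
      exact ⟨k, f, hf⟩

omit [HasColimits C] [HasExt.{v} C] in
/-- Every diagram in a Grothendieck category embeds in a diagram of injective objects. -/
lemma exists_mono_to_pointwise_injective [IsGrothendieckAbelian.{v} C]
    {J : Type v} [SmallCategory J] (D : J ⥤ C) :
    ∃ (E : J ⥤ C) (ι : D ⟶ E), Mono ι ∧ ∀ j, Injective (E.obj j) := by
  let fac := (((MorphismProperty.monomorphisms C).functorialFactorizationData
    (MorphismProperty.monomorphisms C).rlp).functorCategory J).factorizationData
      (0 : D ⟶ (Functor.const J).obj (0 : C))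
  refine ⟨fac.Z, fac.i, ?_, fun j ↦ ?_⟩
  · have (j : J) : Mono (fac.i.app j) := fac.hi j
    exact NatTrans.mono_of_mono_app _
  · rw [injective_iff_rlp_monomorphisms_of_isZero _ (isZero_zero C)]
    exact fac.hp j

omit [HasColimits C] in
/-- Dimension shifting along an injective coresolution. -/
lemma exists_subsingleton_ext_one_iff [EnoughInjectives C] (k : ℕ) (E : C) :
    ∃ Z : C, ∀ F : C, Subsingleton (Ext F Z 1) ↔ Subsingleton (Ext F E (k + 1)) := by
  induction k generalizing E with
  | zero => exact ⟨E, fun F ↦ Iff.rfl⟩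
  | succ k ih =>
    let S := ShortComplex.mk (Injective.ι E) (cokernel.π (Injective.ι E))
      (cokernel.condition _)
    have hS : S.ShortExact := { exact := ShortComplex.exact_cokernel _ }
    have : Injective S.X₂ := inferInstanceAs (Injective (Injective.under E))
    obtain ⟨Z, hZ⟩ := ih S.X₃
    refine ⟨Z, fun F ↦ (hZ F).trans ⟨fun h ↦ subsingleton_of_forall_eq 0 fun x ↦ ?_,
      fun h ↦ subsingleton_of_forall_eq 0 fun x ↦ ?_⟩⟩
    · obtain ⟨y, rfl⟩ := Ext.covariant_sequence_exact₁ F hS x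
        (Ext.eq_zero_of_injective _) rfl
      rw [Subsingleton.elim y 0, Ext.zero_comp]
    · obtain ⟨y, rfl⟩ := Ext.covariant_sequence_exact₃ F hS x rfl (h.elim _ _)
      rw [Ext.eq_zero_of_injective y, Ext.zero_comp]

/-- If `Ext^{m+1}(F,-)` preserves direct limits, it kills direct limits of injectives. -/
lemma ExtPreservesDirlim.subsingleton_ext_colimit {m : ℕ} {F : C}
    (h : ExtPreservesDirlim (m + 1) F) {J : Type v} [SmallCategory J] [IsFiltered J]
    (E : J ⥤ C) [∀ j, Injective (E.obj j)] : Subsingleton (Ext F (colimit E) (m + 1)) := by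
  refine subsingleton_of_forall_eq 0 fun x ↦ ?_
  obtain ⟨j, y, rfl⟩ := ((extPreservesDirlim_iff _ _).1 h J E).1 x
  rw [Ext.eq_zero_of_injective y, Ext.zero_comp]

/-- If `Ext^m(M,-)` preserves direct limits and `Ext^{m+1}(M,-)` kills direct limits of
injective objects, then `Ext^{m+1}(M,-)` preserves direct limits. -/
lemma ExtPreservesDirlim.succ [IsGrothendieckAbelian.{v} C] {m : ℕ} {M : C}
    (h : ExtPreservesDirlim m M)
    (hE : ∀ (J : Type v) [SmallCategory J] [IsFiltered J] (E : J ⥤ C),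
      (∀ j, Injective (E.obj j)) → Subsingleton (Ext M (colimit E) (m + 1))) :
    ExtPreservesDirlim (m + 1) M := by
  rw [extPreservesDirlim_iff] at h ⊢
  intro J _ _ D
  obtain ⟨E, ι, _, hinj⟩ := exists_mono_to_pointwise_injective D
  have := hE J E hinj
  obtain ⟨K, p, w, hS⟩ : ∃ (K : J ⥤ C) (p : E ⟶ K) (w : ι ≫ p = 0),
      (ShortComplex.mk ι p w).ShortExact :=
    ⟨_, cokernel.π ι, cokernel.condition _, { exact := ShortComplex.exact_cokernel _ }⟩
  have wj (j : J) : ι.app j ≫ p.app j = 0 := by rw [← NatTrans.comp_app, w]; rfl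
  have hSj (j : J) : (ShortComplex.mk (ι.app j) (p.app j) (wj j)).ShortExact :=
    hS.map_of_exact ((evaluation J C).obj j)
  have wT : colimMap ι ≫ colimMap p = 0 := ((ShortComplex.mk ι p w).map colim).zero
  have hT : (ShortComplex.mk (colimMap ι) (colimMap p) wT).ShortExact := hS.map_of_exact colim
  let δ (j : J) : Ext (K.obj j) (D.obj j) 1 := (hSj j).extClass
  let δT : Ext (colimit K) (colimit D) 1 := hT.extClass
  have hφ {j k : J} (f : j ⟶ k) : (δ j).comp (Ext.mk₀ (D.map f)) (add_zero 1) =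
      (Ext.mk₀ (K.map f)).comp (δ k) (zero_add 1) :=
    ShortComplex.ShortExact.extClass_naturality (hSj j) (hSj k)
      { τ₁ := D.map f, τ₂ := E.map f, τ₃ := K.map f }
  have hψ (j : J) : (δ j).comp (Ext.mk₀ (colimit.ι D j)) (add_zero 1) =
      (Ext.mk₀ (colimit.ι K j)).comp δT (zero_add 1) :=
    ShortComplex.ShortExact.extClass_naturality (hSj j) hT
      { τ₁ := colimit.ι D j, τ₂ := colimit.ι E j, τ₃ := colimit.ι K j }
  have hpδ (j : J) : (Ext.mk₀ (p.app j)).comp (δ j) (zero_add 1) = 0 := (hSj j).comp_extClass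
  refine ⟨fun x ↦ ?_, fun j x hx ↦ ?_⟩
  · obtain ⟨y, rfl⟩ : ∃ y : Ext M (colimit K) m, y.comp δT rfl = x :=
      Ext.covariant_sequence_exact₁ M hT x (this.elim _ _) rfl
    obtain ⟨j, y, rfl⟩ := (h J K).1 y
    refine ⟨j, y.comp (δ j) rfl, ?_⟩
    rw [Ext.comp_assoc_of_third_deg_zero, hψ, Ext.comp_assoc_of_second_deg_zero]
  · have := hinj j
    obtain ⟨y, rfl⟩ : ∃ y : Ext M (K.obj j) m, y.comp (δ j) rfl = x :=
      Ext.covariant_sequence_exact₁ M (hSj j) x (Ext.eq_zero_of_injective (I := E.obj j) _) rfl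
    rw [Ext.comp_assoc_of_third_deg_zero, hψ, ← Ext.comp_assoc_of_second_deg_zero] at hx
    obtain ⟨z, hz⟩ : ∃ z : Ext M (colimit E) m, z.comp (Ext.mk₀ (colimMap p)) (add_zero m) =
        y.comp (Ext.mk₀ (colimit.ι K j)) (add_zero m) :=
      Ext.covariant_sequence_exact₃ M hT _ rfl hx
    obtain ⟨k, z, rfl⟩ := (h J E).1 z
    let f := IsFiltered.leftToMax j k
    let g := IsFiltered.rightToMax j k
    obtain ⟨q, t, hq⟩ := (h J K).2 _ (y.comp (Ext.mk₀ (K.map f)) (add_zero m) -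
      z.comp (Ext.mk₀ (E.map g ≫ p.app _)) (add_zero m)) (by
        rw [Ext.comp_assoc_of_third_deg_zero, Ext.mk₀_comp_mk₀, ι_colimMap] at hz
        rw [ext_sub_comp_mk₀, Ext.comp_assoc_of_third_deg_zero,
          Ext.comp_assoc_of_third_deg_zero, Ext.mk₀_comp_mk₀, Ext.mk₀_comp_mk₀, colimit.w,
          p.naturality, assoc, colimit.w, hz, sub_self])
    refine ⟨q, f ≫ t, ?_⟩
    rw [ext_sub_comp_mk₀, sub_eq_zero, Ext.comp_assoc_of_third_deg_zero,
      Ext.comp_assoc_of_third_deg_zero, Ext.mk₀_comp_mk₀, Ext.mk₀_comp_mk₀, assoc,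
      ← K.map_comp, ← p.naturality, ← assoc] at hq
    rw [Ext.comp_assoc_of_third_deg_zero, hφ, ← Ext.comp_assoc_of_second_deg_zero, hq,
      ← Ext.mk₀_comp_mk₀, Ext.comp_assoc_of_second_deg_zero,
      Ext.comp_assoc_of_second_deg_zero, hpδ, Ext.comp_zero, Ext.comp_zero]

/-- For `n ≥ 2` in a Grothendieck category,
`FP_n = FP_{n-1} ∩ ⊥₁(FP_n-Inj)`. -/
theorem isTypeFP_iff_isTypeFP_pred_and_leftOrth
    [HasFilteredColimits C] [AB5 C] (hGen : ∃ G : C, IsSeparator G)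
    (n : ℕ) (hn : 2 ≤ n) (M : C) :
    IsTypeFP n M ↔ IsTypeFP (n - 1) M ∧ LeftOrth n M := by
  obtain ⟨m, rfl⟩ := Nat.exists_eq_add_of_le' hn
  refine ⟨fun h ↦ ⟨⟨h.1, fun i hi ↦ h.2 i (by lia)⟩, fun Y hY ↦ hY M h⟩, ?_⟩
  rintro ⟨⟨hFG, hM⟩, horth⟩
  have : HasSeparator C := ⟨hGen⟩
  have : IsGrothendieckAbelian.{v} C := {}
  refine ⟨hFG, fun i hi ↦ ?_⟩
  obtain hi | rfl : i < m + 1 ∨ i = m + 1 := by lia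
  · exact hM i hi
  · refine (hM m (by lia)).succ fun J _ _ E _ ↦ ?_
    obtain ⟨Z, hZ⟩ := exists_subsingleton_ext_one_iff m (colimit E)
    exact (hZ M).1 (horth Z fun F hF ↦
      (hZ F).2 ((hF.2 (m + 1) (by lia)).subsingleton_ext_colimit E))

end FPnPaper
end

section
/- In any Grothendieck category, the class FP_n-Inj of FP_n-injective objects is closed under pure subobjects: if 0 → A → B → C → 0 is a pure exact sequence with B FP_n-injective and n ≥ 1, then A is FP_n-injective. -/
open CategoryTheory Category Limits Opposite

universe v u

namespace FPnPaper

variable {C : Type u} [Category.{v} C] [Abelian C] [HasColimits C] [HasExt.{v} C]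

lemma homEquiv₀_comp_mk₀ {D : Type*} [Category* D] [Abelian D] [HasExt D] {X Y Y' : D}
    (x : Abelian.Ext X Y 0) (p : Y ⟶ Y') :
    Abelian.Ext.homEquiv₀ (x.comp (Abelian.Ext.mk₀ p) (add_zero 0)) =
      Abelian.Ext.homEquiv₀ x ≫ p := by
  apply (Abelian.Ext.mk₀_bijective X Y').1
  rw [Abelian.Ext.mk₀_homEquiv₀_apply, ← Abelian.Ext.mk₀_comp_mk₀,
    Abelian.Ext.mk₀_homEquiv₀_apply]

/-- The functor `Ext⁰(X, -)`, regarded as valued in types, is `Hom(X, -)`. -/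
noncomputable def extZeroForgetIso (X : C) :
    Abelian.extFunctorObj X 0 ⋙ forget AddCommGrpCat.{v} ≅ coyoneda.obj (op X) :=
  NatIso.ofComponents (fun _ ↦ Equiv.toIso Abelian.Ext.homEquiv₀) (fun p ↦ by
    ext x
    exact homEquiv₀_comp_mk₀ x p)

/-- An object of type `FP_n` with `1 ≤ n` is finitely presented. -/
lemma IsTypeFP.isFP {n : ℕ} (hn : 1 ≤ n) {X : C} (hX : IsTypeFP n X) : IsFP X := by
  intro J _ _ D
  obtain ⟨h⟩ := hX.2 0 hn J _ ‹_› D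
  exact ⟨IsColimit.mapCoconeEquiv (extZeroForgetIso X)
    (isColimitOfPreserves (forget AddCommGrpCat.{v}) h)⟩

/-- If every morphism `F ⟶ Z` lifts to the middle term of a short exact sequence
`0 → A → B → Z → 0`, then `Ext¹(F, A)` vanishes as soon as `Ext¹(F, B)` does. -/
lemma subsingleton_ext_one_of_lift {D : Type*} [Category* D] [Abelian D] [HasExt D]
    {A B Z F : D} {f : A ⟶ B} {g : B ⟶ Z} (hses : IsSES f g)
    (hlift : ∀ φ : F ⟶ Z, ∃ ψ : F ⟶ B, ψ ≫ g = φ) (hB : Subsingleton (Abelian.Ext F B 1)) :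
    Subsingleton (Abelian.Ext F A 1) := by
  obtain ⟨w, hS⟩ := hses
  refine subsingleton_of_forall_eq 0 fun x ↦ ?_
  obtain ⟨y, rfl⟩ := Abelian.Ext.covariant_sequence_exact₁ F hS x (Subsingleton.elim _ _)
    (zero_add 1)
  obtain ⟨φ, rfl⟩ := Abelian.Ext.homEquiv₀.symm.surjective y
  obtain ⟨ψ, rfl⟩ := hlift φ
  change (Abelian.Ext.mk₀ (ψ ≫ g)).comp hS.extClass _ = 0
  rw [← Abelian.Ext.mk₀_comp_mk₀, Abelian.Ext.comp_assoc_of_second_deg_zero,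
    hS.comp_extClass, Abelian.Ext.comp_zero]

/-- In any Grothendieck category, for `n ≥ 1` the class of
`FP_n`-injective objects is closed under pure subobjects. -/
theorem isFPInj_of_pure_subobject
    [HasFilteredColimits C] [AB5 C] (hGen : ∃ G : C, IsSeparator G)
    (n : ℕ) (hn : 1 ≤ n) {A B Z : C} (f : A ⟶ B) (g : B ⟶ Z)
    (hses : IsSES f g)
    (hpure : ∀ F : C, IsFP F → ∀ φ : F ⟶ Z, ∃ ψ : F ⟶ B, ψ ≫ g = φ)
    (hB : IsFPInj n B) :
    IsFPInj n A := by
  exact fun F hF ↦ subsingleton_ext_one_of_lift hses (hpure F (hF.isFP hn)) (hB F hF)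

end FPnPaper
end

section
/- In any Grothendieck category, the class of Gorenstein FP_n-injective objects is closed under direct summands: if A ⊕ B is Gorenstein FP_n-injective, then so are A and B. -/
open CategoryTheory Category Limits Opposite

universe v u

namespace FPnPaper

variable {C : Type u} [Category.{v} C] [Abelian C] [HasColimits C] [HasExt.{v} C]

lemma IsSES.exists_lift {A B Z T : C} {f : A ⟶ B} {g : B ⟶ Z} (h : IsSES f g) (x : T ⟶ B)
    (hx : x ≫ g = 0) : ∃ y : T ⟶ A, y ≫ f = x := by
  obtain ⟨w, h⟩ := h
  have := h.mono_f
  exact ⟨h.exact.lift x hx, h.exact.lift_f x hx⟩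

lemma IsSES.of_lift {A B Z : C} {f : A ⟶ B} {g : B ⟶ Z} [Mono f] [Epi g] (w : f ≫ g = 0)
    (h : ∀ (T : C) (x : T ⟶ B), x ≫ g = 0 → ∃ y : T ⟶ A, y ≫ f = x) : IsSES f g := by
  refine ⟨w, { exact := ?_, mono_f := ‹_›, epi_g := ‹_› }⟩
  rw [ShortComplex.exact_iff_exact_up_to_refinements]
  intro T x hx
  obtain ⟨y, hy⟩ := h T x hx
  exact ⟨T, 𝟙 T, inferInstance, y, by simpa using hy.symm⟩

lemma isSES_kernel_ι {B Z : C} (g : B ⟶ Z) [Epi g] : IsSES (kernel.ι g) g :=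
  .of_lift (kernel.condition g) fun _ x hx => ⟨kernel.lift g x hx, kernel.lift_ι g x hx⟩

/-- `X` is a syzygy of `Y` through an injective object: there is a short exact sequence
`0 → X → I → Y → 0` with `I` injective. -/
def IsSyzygy (X Y : C) : Prop :=
  ∃ (I : C) (f : X ⟶ I) (g : I ⟶ Y), Injective I ∧ IsSES f g

/-- `X` belongs to the right orthogonal class, for all positive `Ext` groups, of the
`FP_n`-injective objects. -/
def RightOrth (n : ℕ) (X : C) : Prop :=
  ∀ J : C, IsFPInj n J → ∀ k : ℕ, Subsingleton (Abelian.Ext J X (k + 1))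

lemma isFPInj_of_injective (n : ℕ) (I : C) [Injective I] : IsFPInj n I :=
  fun F _ => Abelian.Ext.subsingleton_of_injective F I 0

/-- If `Ext^1(J, A) = 0`, then morphisms out of `J` lift along cokernels of maps from `A`. -/
lemma IsSES.exists_lift_of_ext {A B Z J : C} {f : A ⟶ B} {g : B ⟶ Z} (h : IsSES f g)
    (hJ : Subsingleton (Abelian.Ext J A 1)) (x : J ⟶ Z) : ∃ y : J ⟶ B, y ≫ g = x := by
  obtain ⟨w, h⟩ := h
  obtain ⟨y, hy⟩ := Abelian.Ext.covariant_sequence_exact₃ J h (Abelian.Ext.mk₀ x) (zero_add 1)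
    (Subsingleton.elim _ _)
  obtain ⟨y, rfl⟩ := (Abelian.Ext.mk₀_bijective _ _).2 y
  exact ⟨y, (Abelian.Ext.mk₀_bijective _ _).1 (by simpa using hy)⟩

/-- If `B` is injective and morphisms `J ⟶ Z` lift to `B`, then `Ext^1(J, A) = 0`. -/
lemma IsSES.ext_one_of_lift {A B Z J : C} {f : A ⟶ B} {g : B ⟶ Z} (h : IsSES f g) [Injective B]
    (hJ : ∀ x : J ⟶ Z, ∃ y : J ⟶ B, y ≫ g = x) : Subsingleton (Abelian.Ext J A 1) := by
  obtain ⟨w, h⟩ := h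
  refine subsingleton_of_forall_eq 0 fun x => ?_
  obtain ⟨z, rfl⟩ := Abelian.Ext.covariant_sequence_exact₁ J h x
    (Abelian.Ext.eq_zero_of_injective _) (zero_add 1)
  obtain ⟨z, rfl⟩ := (Abelian.Ext.mk₀_bijective _ _).2 z
  obtain ⟨y, rfl⟩ := hJ z
  rw [← Abelian.Ext.mk₀_comp_mk₀, Abelian.Ext.comp_assoc_of_second_deg_zero,
    h.comp_extClass, Abelian.Ext.comp_zero]

lemma IsSyzygy.ext_succ {X Y J : C} (h : IsSyzygy X Y) {k : ℕ}
    (hY : Subsingleton (Abelian.Ext J Y (k + 1))) :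
    Subsingleton (Abelian.Ext J X (k + 1 + 1)) := by
  obtain ⟨I, f, g, hI, w, h⟩ := h
  refine subsingleton_of_forall_eq 0 fun x => ?_
  obtain ⟨z, rfl⟩ := Abelian.Ext.covariant_sequence_exact₁ J h x
    (Abelian.Ext.eq_zero_of_injective _) rfl
  rw [Subsingleton.elim z 0, Abelian.Ext.zero_comp]

lemma RightOrth.of_isSyzygy {n : ℕ} {X Y : C} (hX : RightOrth n X) (h : IsSyzygy X Y) :
    RightOrth n Y := by
  obtain ⟨I, f, g, hI, w, h⟩ := h
  intro J hJ k
  have := hX J hJ (k + 1)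
  refine subsingleton_of_forall_eq 0 fun y => ?_
  obtain ⟨z, rfl⟩ := Abelian.Ext.covariant_sequence_exact₃ J h y rfl (Subsingleton.elim _ _)
  rw [Abelian.Ext.eq_zero_of_injective z, Abelian.Ext.zero_comp]

lemma closedUnderExtensions_rightOrth (n : ℕ) : ClosedUnderExtensions (RightOrth (C := C) n) := by
  rintro A B Z f g ⟨w, h⟩ hA hZ J hJ k
  have := hA J hJ k
  have := hZ J hJ k
  refine subsingleton_of_forall_eq 0 fun y => ?_
  obtain ⟨z, rfl⟩ := Abelian.Ext.covariant_sequence_exact₂ J h y (Subsingleton.elim _ _)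
  rw [Subsingleton.elim z 0, Abelian.Ext.zero_comp]

lemma RightOrth.of_retract {n : ℕ} {X Y : C} (hY : RightOrth n Y) (r : Retract X Y) :
    RightOrth n X := by
  intro J hJ k
  have := hY J hJ k
  refine subsingleton_of_forall_eq 0 fun x => ?_
  rw [← Abelian.Ext.comp_mk₀_id x, ← r.retract, ← Abelian.Ext.mk₀_comp_mk₀,
    ← Abelian.Ext.comp_assoc_of_third_deg_zero,
    Subsingleton.elim (x.comp (Abelian.Ext.mk₀ r.i) (add_zero _)) 0, Abelian.Ext.zero_comp]

lemma exists_isSyzygy [EnoughInjectives C] (X : C) : ∃ Y : C, IsSyzygy X Y := by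
  refine ⟨cokernel (Injective.ι X), _, Injective.ι X, cokernel.π _, inferInstance,
    cokernel.condition _, ?_⟩
  exact { exact := ShortComplex.exact_cokernel _ }

/-- Glue a sequence going forwards and one going backwards to a sequence indexed by `ℤ`. -/
lemma exists_int_seq {α : Type*} (R : α → α → Prop) (P Q : α → Prop)
    (hP : ∀ x, P x → ∃ y, P y ∧ R x y) (hQ : ∀ y, Q y → ∃ x, Q x ∧ R x y)
    (x : α) (hPx : P x) (hQx : Q x) :
    ∃ s : ℤ → α, s 0 = x ∧ (∀ i, P (s i) ∨ Q (s i)) ∧ ∀ i, R (s i) (s (i + 1)) := by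
  choose a haP haR using hP
  choose b hbQ hbR using hQ
  let s : ℕ → {y // P y} := fun k => Nat.rec ⟨x, hPx⟩ (fun _ y => ⟨a y.1 y.2, haP y.1 y.2⟩) k
  let t : ℕ → {y // Q y} := fun k => Nat.rec ⟨x, hQx⟩ (fun _ y => ⟨b y.1 y.2, hbQ y.1 y.2⟩) k
  refine ⟨fun i => Int.rec (fun k => (s k).1) (fun k => (t (k + 1)).1) i, rfl, ?_, ?_⟩
  · rintro (k | k)
    · exact Or.inl (s k).2
    · exact Or.inr (t (k + 1)).2
  · rintro (k | _ | k)
    · exact haR (s k).1 (s k).2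
    · exact hbR x hQx
    · exact hbR (t (k + 1)).1 (t (k + 1)).2

/-- A doubly infinite sequence of syzygies in the right orthogonal class splices to a complex
witnessing that its zeroth term is Gorenstein `FP_n`-injective. -/
lemma isGorFPInj_of_seq (n : ℕ) (Z : ℤ → C) (hZ : ∀ i, RightOrth n (Z i))
    (h : ∀ i, IsSyzygy (Z i) (Z (i + 1))) : IsGorFPInj n (Z 0) := by
  choose I f g hI hS using h
  have hf (i) : Mono (f i) := (hS i).2.mono_f
  have hg (i) : Epi (g i) := (hS i).2.epi_g
  have key {T : C} (i : ℤ) (x : T ⟶ I (i + 1)) (hx : x ≫ g (i + 1) ≫ f (i + 1 + 1) = 0) :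
      ∃ z : T ⟶ Z (i + 1), z ≫ f (i + 1) = x :=
    (hS (i + 1)).exists_lift x (by rw [← cancel_mono (f (i + 1 + 1)), assoc, hx, zero_comp])
  refine ⟨I, fun i => g i ≫ f (i + 1), fun i => ?_, hI, fun i => ?_, ?_, ?_⟩
  · rw [assoc, reassoc_of% (hS (i + 1)).1, zero_comp, comp_zero]
  · rw [ShortComplex.exact_iff_exact_up_to_refinements]
    intro T x hx
    obtain ⟨z, rfl⟩ := key i x hx
    obtain ⟨T', π, hπ, y, hy⟩ := surjective_up_to_refinements_of_epi (g i) z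
    exact ⟨T', π, hπ, y, by simp [reassoc_of% hy]⟩
  · intro J hJ i x hx
    obtain ⟨z, rfl⟩ := key i x hx
    obtain ⟨y, rfl⟩ := (hS i).exists_lift_of_ext (hZ i J hJ 0) z
    exact ⟨y, by simp⟩
  · obtain ⟨w, h0⟩ := hS 0
    exact ⟨h0.fIsKernel.conePointUniqueUpToIso (kernelIsKernel (g 0)) ≪≫
      (kernelCompMono (g 0) (f (0 + 1))).symm⟩

/-- Coinduction principle for Gorenstein `FP_n`-injective objects. -/
lemma isGorFPInj_of_class [EnoughInjectives C] (n : ℕ) (S : C → Prop)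
    (hS : ∀ X, S X → RightOrth n X) (hS' : ∀ X, S X → ∃ X', S X' ∧ IsSyzygy X' X)
    (X : C) (hX : S X) : IsGorFPInj n X := by
  obtain ⟨Z, rfl, hZ, h⟩ := exists_int_seq IsSyzygy (RightOrth n) S
    (fun X hX => (exists_isSyzygy X).imp fun _ h => ⟨hX.of_isSyzygy h, h⟩) hS' X (hS X hX) hX
  exact isGorFPInj_of_seq n Z (fun i => (hZ i).elim id (hS _)) h

/-- Gorenstein `FP_n`-injective objects are right orthogonal to the `FP_n`-injective objects and
are cosyzygies of Gorenstein `FP_n`-injective objects. -/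
lemma IsGorFPInj.rightOrth_and_exists_isSyzygy [EnoughInjectives C] {n : ℕ} {M : C}
    (hM : IsGorFPInj n M) :
    RightOrth n M ∧ ∃ X : C, IsGorFPInj n X ∧ IsSyzygy X M := by
  obtain ⟨I, d, w, hI, hex, hlift, ⟨e⟩⟩ := hM
  let p (i : ℤ) : I i ⟶ kernel (d (i + 1)) := kernel.lift _ (d i) (w i)
  have hpι (i) : p i ≫ kernel.ι _ = d i := kernel.lift_ι _ _ _
  have hp (i) : Epi (p i) := by
    rw [epi_iff_surjective_up_to_refinements]
    intro T y
    obtain ⟨T', π, hπ, x, hx⟩ := (hex i).exact_up_to_refinements (y ≫ kernel.ι _) (by simp)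
    refine ⟨T', π, hπ, x, ?_⟩
    rw [← cancel_mono (kernel.ι _), assoc, assoc, hpι]
    exact hx
  have hses (i) : IsSES (kernel.ι (d i)) (p i) :=
    .of_lift (by rw [← cancel_mono (kernel.ι _), assoc, hpι, kernel.condition, zero_comp])
      fun T x hx => ⟨kernel.lift _ x (by rw [← hpι, reassoc_of% hx, zero_comp]), by simp⟩
  have hsyz (i) : IsSyzygy (kernel (d i)) (kernel (d (i + 1))) := ⟨_, _, _, hI i, hses i⟩
  have horth (i) : RightOrth n (kernel (d i)) := by
    intro J hJ k
    induction k generalizing i with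
    | zero =>
      have := hI i
      refine (hses i).ext_one_of_lift fun x => ?_
      obtain ⟨y, hy⟩ := hlift J hJ i (x ≫ kernel.ι _) (by simp)
      exact ⟨y, by rw [← cancel_mono (kernel.ι _), assoc, hpι, hy]⟩
    | succ k ih => exact (hsyz i).ext_succ (ih (i + 1))
  have hgor : IsGorFPInj n (kernel (d (-1))) := by
    refine isGorFPInj_of_class n (fun X => ∃ i, X = kernel (d i)) ?_ ?_ _ ⟨-1, rfl⟩
    · rintro _ ⟨i, rfl⟩
      exact horth i
    · rintro _ ⟨i, rfl⟩
      obtain ⟨i, rfl⟩ : ∃ j, i = j + 1 := ⟨i - 1, by lia⟩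
      exact ⟨_, ⟨i, rfl⟩, hsyz i⟩
  refine ⟨(horth 0).of_retract (Retract.ofIso e), _, hgor, _, kernel.ι (d (-1)),
    p (-1) ≫ e.inv, hI _, ?_⟩
  refine .of_lift (by rw [reassoc_of% (hses (-1)).1, zero_comp]) fun T x hx =>
    (hses (-1)).exists_lift x ?_
  rw [← cancel_mono e.inv, assoc, hx, zero_comp]

/-- Horseshoe lemma for syzygies: the obstruction `Ext^1` vanishes on injective objects. -/
lemma IsSES.exists_syzygy {A B Z A' Z' : C} {f : A ⟶ B} {g : B ⟶ Z} (h : IsSES f g)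
    (hA : ∀ I : C, Injective I → Subsingleton (Abelian.Ext I A 1))
    (hA' : IsSyzygy A' A) (hZ' : IsSyzygy Z' Z) :
    ∃ (B' : C) (f' : A' ⟶ B') (g' : B' ⟶ Z'), IsSES f' g' ∧ IsSyzygy B' B := by
  obtain ⟨I, a, p, hI, hap⟩ := hA'
  obtain ⟨K, c, q, hK, hcq⟩ := hZ'
  obtain ⟨l, rfl⟩ := h.exists_lift_of_ext (hA K hK) q
  have := h.2.mono_f
  have := hap.2.mono_f
  have := hap.2.epi_g
  have := hcq.2.mono_f
  have := hcq.2.epi_g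
  let φ : I ⊞ K ⟶ B := biprod.desc (p ≫ f) l
  have hφ : Epi φ := by
    rw [epi_iff_surjective_up_to_refinements]
    intro T y
    obtain ⟨T₁, π₁, hπ₁, z, hz⟩ := surjective_up_to_refinements_of_epi (l ≫ g) (y ≫ g)
    obtain ⟨t, ht⟩ := h.exists_lift (π₁ ≫ y - z ≫ l) (by simp [hz])
    obtain ⟨T₂, π₂, hπ₂, s, hs⟩ := surjective_up_to_refinements_of_epi p t
    refine ⟨T₂, π₂ ≫ π₁, epi_comp _ _, biprod.lift s (π₂ ≫ z), ?_⟩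
    simp only [φ, biprod.lift_desc]
    rw [← reassoc_of% hs, ht]
    simp
  have hsnd : (kernel.ι φ ≫ biprod.snd) ≫ l ≫ g = 0 := by
    have : biprod.snd ≫ l ≫ g = φ ≫ g := by
      ext
      · simp [φ, h.1]
      · simp [φ]
    rw [assoc, this, kernel.condition_assoc, zero_comp]
  obtain ⟨g', hg'⟩ := hcq.exists_lift _ hsnd
  let f' : A' ⟶ kernel φ := kernel.lift φ (a ≫ biprod.inl) (by simp [φ, reassoc_of% hap.1])
  have hf' : f' ≫ kernel.ι φ = a ≫ biprod.inl := kernel.lift_ι _ _ _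
  have : Mono f' := by
    have : Mono (f' ≫ kernel.ι φ) := by rw [hf']; infer_instance
    exact mono_of_mono f' (kernel.ι φ)
  have : Epi g' := by
    rw [epi_iff_surjective_up_to_refinements]
    intro T y
    obtain ⟨t, ht⟩ := h.exists_lift (y ≫ c ≫ l) (by simp [hcq.1])
    obtain ⟨T₁, π, hπ, s, hs⟩ := surjective_up_to_refinements_of_epi p t
    refine ⟨T₁, π, hπ, kernel.lift φ (biprod.lift (-s) (π ≫ y ≫ c)) ?_, ?_⟩
    · simp only [φ, biprod.lift_desc]
      rw [Preadditive.neg_comp, ← reassoc_of% hs, ht]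
      simp
    · rw [← cancel_mono c]
      simp [hg']
  refine ⟨kernel φ, f', g', .of_lift ?_ ?_, _, _, φ, inferInstance, isSES_kernel_ι φ⟩
  · rw [← cancel_mono c, assoc, hg', reassoc_of% hf']
    simp
  · intro T x hx
    have hx₂ : x ≫ kernel.ι φ ≫ biprod.snd = 0 := by rw [← hg', reassoc_of% hx, zero_comp]
    have hx₁ : x ≫ kernel.ι φ = (x ≫ kernel.ι φ ≫ biprod.fst) ≫ biprod.inl := by
      ext <;> simp [hx₂]
    obtain ⟨y, hy⟩ := hap.exists_lift (x ≫ kernel.ι φ ≫ biprod.fst) (by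
      have := x ≫= kernel.condition φ
      rw [reassoc_of% hx₁] at this
      rw [← cancel_mono f]
      simpa [φ] using this)
    exact ⟨y, by rw [← cancel_mono (kernel.ι φ), assoc, hf', reassoc_of% hy, hx₁]; simp⟩

lemma closedUnderExtensions_isGorFPInj [EnoughInjectives C] (n : ℕ) :
    ClosedUnderExtensions (IsGorFPInj (C := C) n) := by
  intro A B Z f g h hA hZ
  refine isGorFPInj_of_class n (fun X => ∃ (A Z : C) (f : A ⟶ X) (g : X ⟶ Z),
    IsSES f g ∧ IsGorFPInj n A ∧ IsGorFPInj n Z) ?_ ?_ B ⟨A, Z, f, g, h, hA, hZ⟩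
  · rintro X ⟨A, Z, f, g, h, hA, hZ⟩
    exact closedUnderExtensions_rightOrth n f g h hA.rightOrth_and_exists_isSyzygy.1
      hZ.rightOrth_and_exists_isSyzygy.1
  · rintro X ⟨A, Z, f, g, h, hA, hZ⟩
    obtain ⟨hAo, A', hA', hA'A⟩ := hA.rightOrth_and_exists_isSyzygy
    obtain ⟨-, Z', hZ', hZ'Z⟩ := hZ.rightOrth_and_exists_isSyzygy
    obtain ⟨X', f', g', h', hX'⟩ := h.exists_syzygy
      (fun I _ => hAo I (isFPInj_of_injective n I) 0) hA'A hZ'Z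
    exact ⟨X', ⟨A', Z', f', g', h', hA', hZ'⟩, hX'⟩

/-- If `X` is a retract of `M` and `p : I ⟶ M` is an epimorphism with kernel `K`, then the kernel
`L` of `I ⟶ M ⟶ X` fits in a short exact sequence `0 → K → L ⊞ X → M → 0`. -/
lemma isSES_kernel_comp_retract {X M I K : C} (r : Retract X M) {k : K ⟶ I} {p : I ⟶ M}
    (h : IsSES k p) :
    IsSES (kernel.lift (p ≫ r.r) k (by rw [reassoc_of% h.1, zero_comp]) ≫
        (biprod.inl : _ ⟶ kernel (p ≫ r.r) ⊞ X))
      (biprod.desc (kernel.ι (p ≫ r.r) ≫ p) r.i) := by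
  have := h.2.mono_f
  have := h.2.epi_g
  have : Epi (biprod.desc (kernel.ι (p ≫ r.r) ≫ p) r.i) := by
    rw [epi_iff_surjective_up_to_refinements]
    intro T y
    obtain ⟨T', π, hπ, x, hx⟩ := surjective_up_to_refinements_of_epi p (y - y ≫ r.r ≫ r.i)
    refine ⟨T', π, hπ, biprod.lift (kernel.lift _ x ?_) (π ≫ y ≫ r.r), ?_⟩
    · rw [← reassoc_of% hx]
      simp
    · simp [← hx]
  refine .of_lift (by simp [h.1]) fun T x hx => ?_
  have hx' : x = biprod.lift (x ≫ biprod.fst) (x ≫ biprod.snd) := by ext <;> simp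
  rw [hx', biprod.lift_desc] at hx
  have hx₂ : x ≫ biprod.snd = 0 := by simpa using hx =≫ r.r
  obtain ⟨y, hy⟩ := h.exists_lift (x ≫ biprod.fst ≫ kernel.ι (p ≫ r.r))
    (by simpa [hx₂] using hx)
  refine ⟨y, ?_⟩
  ext
  · simp [hy]
  · simp [hx₂]

lemma IsGorFPInj.of_retract [EnoughInjectives C] {n : ℕ} {X M : C} (hM : IsGorFPInj n M)
    (r : Retract X M) : IsGorFPInj n X := by
  refine isGorFPInj_of_class n (fun X => ∃ M : C, IsGorFPInj n M ∧ Nonempty (Retract X M))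
    ?_ ?_ X ⟨M, hM, ⟨r⟩⟩
  · rintro X ⟨M, hM, ⟨r⟩⟩
    exact hM.rightOrth_and_exists_isSyzygy.1.of_retract r
  · rintro X ⟨M, hM, ⟨r⟩⟩
    obtain ⟨-, K, hK, I, k, p, hI, h⟩ := hM.rightOrth_and_exists_isSyzygy
    have := h.2.epi_g
    have : Epi (p ≫ r.r) := epi_comp _ _
    exact ⟨kernel (p ≫ r.r),
      ⟨_, closedUnderExtensions_isGorFPInj n _ _ (isSES_kernel_comp_retract r h) hK hM,
        ⟨{ i := biprod.inl, r := biprod.fst }⟩⟩,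
      I, _, p ≫ r.r, hI, isSES_kernel_ι _⟩

/-- In any Grothendieck category, the class of Gorenstein
`FP_n`-injective objects is closed under direct summands. -/
theorem isGorFPInj_of_summand
    [HasFilteredColimits C] [AB5 C] (hGen : ∃ G : C, IsSeparator G)
    (n : ℕ) (A B : C) (h : IsGorFPInj n (A ⊞ B)) :
    IsGorFPInj n A ∧ IsGorFPInj n B := by
  have : HasSeparator C := ⟨hGen⟩
  have : IsGrothendieckAbelian.{v} C := {}
  exact ⟨h.of_retract { i := biprod.inl, r := biprod.fst },
    h.of_retract { i := biprod.inr, r := biprod.snd }⟩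

end FPnPaper
end
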